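/- For every commutative ℂ-algebra A, there exists a Lie algebra structure (over ℂ) on the free A-module with basis {B^n_k : (n,k) ∈ ℕ×ℕ} whose bracket is ℂ-bilinear and satisfies, for all f, g ∈ A and all n, k, N, K ∈ ℕ, ⁅g·B^n_k, f·B^N_K⁆ = (kN − Kn)·(g·f)·B^{n+N−1}_{k+K−1}; i.e. this bracket is antisymmetric and satisfies the Jacobi identity (when the integer coefficient kN − Kn equals 0 the right-hand side is 0, so the indices n+N−1, k+K−1 are only needed when they are nonnegative). -/

import Mathlib

namespace RHPWN

/-- The structure constant `kN − Kn` of the RHPWN commutation relations. -/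
def coeff (p q : ℕ × ℕ) : ℤ := p.2 * q.1 - q.2 * p.1

/-- The index `(n + N − 1, k + K − 1)`, with truncated subtraction. -/
def index (p q : ℕ × ℕ) : ℕ × ℕ := (p.1 + q.1 - 1, p.2 + q.2 - 1)

theorem coeff_swap (p q : ℕ × ℕ) : coeff p q = -coeff q p := by
  simp only [coeff]; ring

theorem index_comm (p q : ℕ × ℕ) : index p q = index q p := by
  simp only [index, add_comm]

theorem one_le_of_coeff_ne_zero {p q : ℕ × ℕ} (h : coeff p q ≠ 0) :
    1 ≤ p.1 + q.1 ∧ 1 ≤ p.2 + q.2 := by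
  constructor <;>
  · by_contra! hlt
    obtain ⟨hp, hq⟩ := Nat.add_eq_zero_iff.mp (Nat.lt_one_iff.mp hlt)
    exact h (by simp [coeff, hp, hq])

theorem coeff_mul_coeff_index (p q r : ℕ × ℕ) :
    coeff p q * coeff (index p q) r =
      coeff p q * ((p.2 + q.2 - 1) * r.1 - r.2 * (p.1 + q.1 - 1)) := by
  by_cases h : coeff p q = 0
  · simp [h]
  · obtain ⟨h₁, h₂⟩ := one_le_of_coeff_ne_zero h
    congr 1
    simp only [coeff, index]
    push_cast [Nat.cast_sub h₁, Nat.cast_sub h₂]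
    ring

theorem coeff_jacobi (p q r : ℕ × ℕ) :
    coeff p q * coeff (index p q) r + coeff q r * coeff (index q r) p +
      coeff r p * coeff (index r p) q = 0 := by
  simp only [coeff_mul_coeff_index]
  simp only [coeff]
  ring

variable {A : Type*} [CommRing A] [Algebra ℂ A]

theorem smul_single_index_index (p q r : ℕ × ℕ) (a : A) :
    ((coeff p q * coeff (index p q) r : ℤ) : ℂ) • Finsupp.single (index (index p q) r) a =
      ((coeff p q * coeff (index p q) r : ℤ) : ℂ) •
        Finsupp.single (p.1 + q.1 + r.1 - 2, p.2 + q.2 + r.2 - 2) a := by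
  by_cases h : coeff p q = 0
  · simp [h]
  · obtain ⟨h₁, h₂⟩ := one_le_of_coeff_ne_zero h
    congr 2
    ext <;> simp only [index] <;> omega

variable (A) in
/-- The RHPWN bracket on the free `A`-module with basis `ℕ × ℕ`. -/
noncomputable def bracket :
    ((ℕ × ℕ) →₀ A) →ₗ[ℂ] ((ℕ × ℕ) →₀ A) →ₗ[ℂ] ((ℕ × ℕ) →₀ A) :=
  Finsupp.lsum ℂ fun p => LinearMap.flip <| Finsupp.lsum ℂ fun q => LinearMap.flip <|
    (coeff p q : ℂ) • (LinearMap.mul ℂ A).compr₂ (Finsupp.lsingle (index p q))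

theorem bracket_single (p q : ℕ × ℕ) (g f : A) :
    bracket A (Finsupp.single p g) (Finsupp.single q f) =
      (coeff p q : ℂ) • Finsupp.single (index p q) (g * f) := by
  simp [bracket]

theorem bracket_swap (x y : (ℕ × ℕ) →₀ A) : bracket A x y = -bracket A y x := by
  induction x using Finsupp.induction_linear with
  | zero => simp
  | add x₁ x₂ h₁ h₂ => simp only [map_add, LinearMap.add_apply, h₁, h₂, neg_add]
  | single p g =>
    induction y using Finsupp.induction_linear with
    | zero => simp
    | add y₁ y₂ h₁ h₂ => simp only [map_add, LinearMap.add_apply, h₁, h₂, neg_add]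
    | single q f =>
      rw [bracket_single, bracket_single, coeff_swap, index_comm, mul_comm g f, Int.cast_neg,
        neg_smul]

theorem bracket_bracket_single (p q r : ℕ × ℕ) (a b c : A) :
    bracket A (bracket A (Finsupp.single p a) (Finsupp.single q b)) (Finsupp.single r c) =
      ((coeff p q * coeff (index p q) r : ℤ) : ℂ) •
        Finsupp.single (p.1 + q.1 + r.1 - 2, p.2 + q.2 + r.2 - 2) (a * b * c) := by
  rw [bracket_single, map_smul, LinearMap.smul_apply, bracket_single, smul_smul, ← Int.cast_mul,
    smul_single_index_index]

theorem bracket_jacobi (x y z : (ℕ × ℕ) →₀ A) :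
    bracket A (bracket A x y) z + bracket A (bracket A y z) x + bracket A (bracket A z x) y = 0 := by
  induction x using Finsupp.induction_linear with
  | zero => simp
  | add x₁ x₂ h₁ h₂ =>
    simp only [map_add, LinearMap.add_apply]
    linear_combination (norm := abel) h₁ + h₂
  | single p a =>
    induction y using Finsupp.induction_linear with
    | zero => simp
    | add y₁ y₂ h₁ h₂ =>
      simp only [map_add, LinearMap.add_apply]
      linear_combination (norm := abel) h₁ + h₂
    | single q b =>
      induction z using Finsupp.induction_linear with
      | zero => simp
      | add z₁ z₂ h₁ h₂ =>
        simp only [map_add, LinearMap.add_apply]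
        linear_combination (norm := abel) h₁ + h₂
      | single r c =>
        rw [bracket_bracket_single, bracket_bracket_single, bracket_bracket_single,
          show b * c * a = a * b * c by ring, show c * a * b = a * b * c by ring,
          show q.1 + r.1 + p.1 = p.1 + q.1 + r.1 by ring,
          show q.2 + r.2 + p.2 = p.2 + q.2 + r.2 by ring,
          show r.1 + p.1 + q.1 = p.1 + q.1 + r.1 by ring,
          show r.2 + p.2 + q.2 = p.2 + q.2 + r.2 by ring,
          ← add_smul, ← add_smul, ← Int.cast_add, ← Int.cast_add, coeff_jacobi, Int.cast_zero,
          zero_smul]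

end RHPWN


/-- For every commutative `ℂ`-algebra `A` of test functions, the RHPWN commutation relations
(convolution-type renormalization) define a Lie algebra structure on the free `A`-module with
basis `{B^n_k : (n,k) ∈ ℕ×ℕ}`: there is a `ℂ`-bilinear, antisymmetric bracket satisfying the
Jacobi identity with `⁅g·B^n_k, f·B^N_K⁆ = (kN − Kn) (gf)·B^{n+N−1}_{k+K−1}`. -/
theorem exists_RHPWN_lieAlgebra (A : Type) [CommRing A] [Algebra ℂ A] :
    ∃ bracket : ((ℕ × ℕ) →₀ A) →ₗ[ℂ] ((ℕ × ℕ) →₀ A) →ₗ[ℂ] ((ℕ × ℕ) →₀ A),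
      (∀ x y, bracket x y = - bracket y x) ∧
      (∀ x y z,
        bracket (bracket x y) z + bracket (bracket y z) x + bracket (bracket z x) y = 0) ∧
      (∀ (f g : A) (n k N K : ℕ),
        bracket (Finsupp.single (n, k) g) (Finsupp.single (N, K) f) =
          ((k * N - K * n : ℤ) : ℂ) • Finsupp.single (n + N - 1, k + K - 1) (g * f)) := by
  exact ⟨RHPWN.bracket A, RHPWN.bracket_swap, RHPWN.bracket_jacobi,
    fun f g n k N K => RHPWN.bracket_single (n, k) (N, K) g f⟩
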